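/- Let n ≥ 2, let F = (f_{k,j})_{k,j=1}^n be a matrix-valued function on (0,1) with complex integrable entries, let F⋆ be its adjoint, and let λ ∈ ℂ. Let J be the n×n matrix whose only nonzero entries are J_{k,n+1−k} = (−1)^{k+1}, let J₀, J₁ be n×n matrices whose entries vanish off the antidiagonal, and let U₀, U₁, U₀⋆, U₁⋆ be n×n complex matrices with (U₀⋆)ᵀ·J₀·U₀ = J and (U₁⋆)ᵀ·J₁·U₁ = J. For each k = 1,…,n let (Φ_{k,0},…,Φ_{k,n}) be a quasi-derivative chain with respect to F holding in integrated form on [0,1] with Φ_{k,n} = λ·Φ_{k,0} a.e., and let (Φ⋆_{k,0},…,Φ⋆_{k,n}) be a quasi-derivative chain with respect to F⋆ holding in integrated form on [0,1] with (−1)^n·Φ⋆_{k,n} = λ·Φ⋆_{k,0} a.e. Let Φ(x) (resp. Φ⋆(x)) be the n×n matrix whose (s,k) entry is Φ_{k,s−1}(x) (resp. Φ⋆_{k,s−1}(x)). Assume the boundary conditions: for each k, (U₀·Φ(0))_{s,k} = δ_{s,k} for 1 ≤ s ≤ k and (U₁·Φ(1))_{s,k} = 0 for k < s ≤ n, and likewise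 (U₀⋆·Φ⋆(0))_{s,k} = δ_{s,k} for 1 ≤ s ≤ k and (U₁⋆·Φ⋆(1))_{s,k} = 0 for k < s ≤ n. Then Φ⋆(x)ᵀ·J·Φ(x) = J₀ for every x ∈ [0,1]; in particular, with M := U₀·Φ(0) and M⋆ := U₀⋆·Φ⋆(0), one has (M⋆)ᵀ·J₀·M = J₀. -/

import Mathlib

open MeasureTheory Matrix

/-- A quasi-derivative chain `y₀, …, yₙ` with respect to the matrix function
`f` (with 1-based indices `f k j`, `1 ≤ k, j ≤ n`), holding in integrated form on `[0,1]`. -/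
def QuasiChainInt (n : ℕ) (f : ℕ → ℕ → ℝ → ℂ) (y : ℕ → ℝ → ℂ) : Prop :=
  ∀ k, 1 ≤ k → k ≤ n →
    ContinuousOn (y (k - 1)) (Set.Icc 0 1) ∧
    IntegrableOn (fun t => y k t + ∑ j ∈ Finset.Icc 1 k, f k j t * y (j - 1) t)
      (Set.Ioo 0 1) ∧
    ∀ x ∈ Set.Icc (0 : ℝ) 1,
      y (k - 1) x = y (k - 1) 0 +
        ∫ t in (0 : ℝ)..x, (y k t + ∑ j ∈ Finset.Icc 1 k, f k j t * y (j - 1) t)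

section AbsoluteContinuity

theorem AbsolutelyContinuousOnInterval.congr_of_eqOn {X : Type*} [PseudoMetricSpace X]
    {f g : ℝ → X} {a b : ℝ} (hf : AbsolutelyContinuousOnInterval f a b)
    (hfg : Set.EqOn f g (Set.uIcc a b)) : AbsolutelyContinuousOnInterval g a b := by
  rw [absolutelyContinuousOnInterval_iff] at hf ⊢
  intro ε hε
  obtain ⟨δ, hδ, h⟩ := hf ε hε
  refine ⟨δ, hδ, fun E hE hlt => ?_⟩
  convert h E hE hlt using 1
  refine Finset.sum_congr rfl fun i hi => ?_
  have hmem := hE.1 i hi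
  rw [hfg hmem.1, hfg hmem.2]

theorem absolutelyContinuousOnInterval_const {F : Type*} [NormedAddCommGroup F]
    [NormedSpace ℝ F] (c : F) (a b : ℝ) :
    AbsolutelyContinuousOnInterval (fun _ => c) a b :=
  contDiffOn_const.absolutelyContinuousOnInterval

theorem AbsolutelyContinuousOnInterval.finset_sum {ι F : Type*} [NormedAddCommGroup F]
    [NormedSpace ℝ F] {f : ι → ℝ → F} {a b : ℝ} (s : Finset ι)
    (hf : ∀ i ∈ s, AbsolutelyContinuousOnInterval (f i) a b) :
    AbsolutelyContinuousOnInterval (fun x => ∑ i ∈ s, f i x) a b := by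
  classical
  induction s using Finset.induction_on with
  | empty => simpa using absolutelyContinuousOnInterval_const (0 : F) a b
  | insert i s his ih =>
    simp only [Finset.sum_insert his]
    exact (hf i (by simp)).add (ih fun j hj => hf j (by simp [hj]))

theorem IntervalIntegrable.absolutelyContinuousOnInterval_integral_complex {g : ℝ → ℂ}
    {a b c : ℝ} (hg : IntervalIntegrable g volume a b) (hc : c ∈ Set.uIcc a b) :
    AbsolutelyContinuousOnInterval (fun x => ∫ t in c..x, g t) a b := by
  have hre : IntervalIntegrable (fun t => (g t).re) volume a b := ⟨hg.1.re, hg.2.re⟩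
  have him : IntervalIntegrable (fun t => (g t).im) volume a b := ⟨hg.1.im, hg.2.im⟩
  have h := ((hre.absolutelyContinuousOnInterval_intervalIntegral hc).smul
      (absolutelyContinuousOnInterval_const (1 : ℂ) a b)).add
    ((him.absolutelyContinuousOnInterval_intervalIntegral hc).smul
      (absolutelyContinuousOnInterval_const Complex.I a b))
  refine h.congr_of_eqOn fun x hx => ?_
  have hgx : IntervalIntegrable g volume c x := hg.mono_set (Set.uIcc_subset_uIcc hc hx)
  have hr : ∫ t in c..x, (g t).re = (∫ t in c..x, g t).re :=
    Complex.reCLM.intervalIntegral_comp_comm hgx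
  have hi : ∫ t in c..x, (g t).im = (∫ t in c..x, g t).im :=
    Complex.imCLM.intervalIntegral_comp_comm hgx
  simp [hr, hi, Complex.re_add_im]

end AbsoluteContinuity

section QuasiDerivatives

variable {n : ℕ} {f : ℕ → ℕ → ℝ → ℂ} {y : ℕ → ℝ → ℂ}

/-- The right-hand side of the first-order equation for the `k`-th quasi-derivative, counted
from zero. -/
def quasiRhs (f : ℕ → ℕ → ℝ → ℂ) (y : ℕ → ℝ → ℂ) (k : ℕ) (x : ℝ) : ℂ :=
  y (k + 1) x + ∑ j ∈ Finset.range (k + 1), f (k + 1) (j + 1) x * y j x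

theorem quasiRhs_eq (f : ℕ → ℕ → ℝ → ℂ) (y : ℕ → ℝ → ℂ) (k : ℕ) (x : ℝ) :
    y (k + 1) x + ∑ j ∈ Finset.Icc 1 (k + 1), f (k + 1) j x * y (j - 1) x = quasiRhs f y k x := by
  rw [quasiRhs, Finset.range_eq_Ico, ← Finset.Ico_add_one_right_eq_Icc,
    ← Finset.sum_Ico_add' _ 0 (k + 1) 1]
  simp

theorem QuasiChainInt.intervalIntegrable (h : QuasiChainInt n f y) {k : ℕ} (hk : k < n) :
    IntervalIntegrable (quasiRhs f y k) volume 0 1 := by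
  rw [intervalIntegrable_iff_integrableOn_Ioo_of_le zero_le_one]
  have := (h (k + 1) (by omega) hk).2.1
  simpa only [quasiRhs_eq] using this

theorem QuasiChainInt.eq_integral (h : QuasiChainInt n f y) {k : ℕ} (hk : k < n) {x : ℝ}
    (hx : x ∈ Set.Icc (0 : ℝ) 1) : y k x = y k 0 + ∫ t in (0 : ℝ)..x, quasiRhs f y k t := by
  have := (h (k + 1) (by omega) hk).2.2 x hx
  simpa only [quasiRhs_eq, Nat.add_sub_cancel] using this

theorem QuasiChainInt.absolutelyContinuousOnInterval (h : QuasiChainInt n f y) {k : ℕ}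
    (hk : k < n) : AbsolutelyContinuousOnInterval (y k) 0 1 := by
  have hac := (absolutelyContinuousOnInterval_const (y k 0) 0 1).add
    ((h.intervalIntegrable hk).absolutelyContinuousOnInterval_integral_complex
      (c := 0) (by simp))
  refine hac.congr_of_eqOn fun x hx => ?_
  rw [Set.uIcc_of_le zero_le_one] at hx
  exact (h.eq_integral hk hx).symm

theorem QuasiChainInt.ae_hasDerivAt (h : QuasiChainInt n f y) {k : ℕ} (hk : k < n) :
    ∀ᵐ x, x ∈ Set.Ioo (0 : ℝ) 1 → HasDerivAt (y k) (quasiRhs f y k x) x := by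
  filter_upwards [(h.intervalIntegrable hk).ae_hasDerivAt_integral] with x hx hx01
  have hd := (hx (by rw [Set.uIcc_of_le zero_le_one]; exact Set.Ioo_subset_Icc_self hx01) 0
    (by simp)).const_add (y k 0)
  refine hd.congr_of_eventuallyEq ?_
  filter_upwards [isOpen_Ioo.mem_nhds hx01] with t ht
  exact h.eq_integral hk (Set.Ioo_subset_Icc_self ht)

/-- The Lagrange bracket of two quasi-derivative chains of length `n`. -/
def lagrangeBracket (n : ℕ) (z y : ℕ → ℝ → ℂ) (x : ℝ) : ℂ :=
  ∑ i ∈ Finset.range n, (-1 : ℂ) ^ i * (z i x * y (n - 1 - i) x)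

/-- The pointwise Lagrange identity for two chains that solve mutually adjoint equations. -/
theorem sum_quasiRhs_mul_add_mul_quasiRhs_eq_zero {fstar : ℕ → ℕ → ℝ → ℂ} {z : ℕ → ℝ → ℂ}
    {lam : ℂ} {x : ℝ}
    (hfstar : ∀ k j x, fstar k j x = (-1 : ℂ) ^ (k + j + 1) * f (n - j + 1) (n - k + 1) x)
    (hy : y n x = lam * y 0 x) (hz : (-1 : ℂ) ^ n * z n x = lam * z 0 x) :
    ∑ i ∈ Finset.range n, (-1 : ℂ) ^ i *
      (quasiRhs fstar z i x * y (n - 1 - i) x + z i x * quasiRhs f y (n - 1 - i) x) = 0 := by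
  have htel : ∑ i ∈ Finset.range n, (-1 : ℂ) ^ i *
      (z (i + 1) x * y (n - 1 - i) x + z i x * y (n - 1 - i + 1) x) = 0 := by
    let g : ℕ → ℂ := fun i => (-1 : ℂ) ^ i * (z i x * y (n - i) x)
    calc _ = ∑ i ∈ Finset.range n, (g i - g (i + 1)) := by
          refine Finset.sum_congr rfl fun i hi => ?_
          have hi' := Finset.mem_range.mp hi
          simp only [g, show n - 1 - i + 1 = n - i by omega,
            show n - (i + 1) = n - 1 - i by omega, pow_succ]
          ring
      _ = g 0 - g n := Finset.sum_range_sub' g n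
      _ = 0 := by
          simp only [g, Nat.sub_zero, Nat.sub_self, pow_zero]
          linear_combination z 0 x * hy - y 0 x * hz
  have hcoef : ∑ i ∈ Finset.range n, (-1 : ℂ) ^ i *
        ((∑ j ∈ Finset.range (i + 1), fstar (i + 1) (j + 1) x * z j x) * y (n - 1 - i) x) =
      ∑ i ∈ Finset.range n, -((-1 : ℂ) ^ i *
        (z i x * ∑ j ∈ Finset.range (n - 1 - i + 1), f (n - 1 - i + 1) (j + 1) x * y j x)) := by
    simp only [Finset.sum_mul, Finset.mul_sum, ← Finset.sum_neg_distrib]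
    rw [Finset.sum_sigma', Finset.sum_sigma']
    refine Finset.sum_nbij' (fun p => ⟨p.2, n - 1 - p.1⟩) (fun p => ⟨n - 1 - p.2, p.1⟩)
      ?_ ?_ ?_ ?_ ?_
    · rintro ⟨i, j⟩ h
      simp only [Finset.mem_sigma, Finset.mem_range] at h ⊢
      omega
    · rintro ⟨i, j⟩ h
      simp only [Finset.mem_sigma, Finset.mem_range] at h ⊢
      omega
    · rintro ⟨i, j⟩ h
      simp only [Finset.mem_sigma, Finset.mem_range] at h
      simp only [show n - 1 - (n - 1 - i) = i by omega]
    · rintro ⟨i, j⟩ h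
      simp only [Finset.mem_sigma, Finset.mem_range] at h
      simp only [show n - 1 - (n - 1 - j) = j by omega]
    · rintro ⟨i, j⟩ h
      simp only [Finset.mem_sigma, Finset.mem_range] at h
      simp only [hfstar, show n - (j + 1) + 1 = n - 1 - j + 1 by omega,
        show n - (i + 1) + 1 = n - 1 - i + 1 by omega]
      have hsq : (-1 : ℂ) ^ i * (-1) ^ i = 1 := by rw [← mul_pow]; simp
      simp only [pow_add, pow_one]
      linear_combination (-(-1 : ℂ) ^ j * f (n - 1 - j + 1) (n - 1 - i + 1) x * z j x *
        y (n - 1 - i) x) * hsq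
  rw [Finset.sum_neg_distrib] at hcoef
  simp only [quasiRhs]
  rw [← add_eq_zero_iff_eq_neg, ← Finset.sum_add_distrib] at hcoef
  rw [← add_zero (0 : ℂ)]
  nth_rewrite 1 [← htel]
  rw [← hcoef, ← Finset.sum_add_distrib]
  refine Finset.sum_congr rfl fun i _ => ?_
  ring

theorem lagrangeBracket_eq_const {fstar : ℕ → ℕ → ℝ → ℂ} {z : ℕ → ℝ → ℂ} {lam : ℂ}
    (hfstar : ∀ k j x, fstar k j x = (-1 : ℂ) ^ (k + j + 1) * f (n - j + 1) (n - k + 1) x)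
    (hy : QuasiChainInt n f y) (hz : QuasiChainInt n fstar z)
    (hyeq : ∀ᵐ x ∂(volume.restrict (Set.Ioo (0 : ℝ) 1)), y n x = lam * y 0 x)
    (hzeq : ∀ᵐ x ∂(volume.restrict (Set.Ioo (0 : ℝ) 1)), (-1 : ℂ) ^ n * z n x = lam * z 0 x) :
    ∃ C, ∀ x ∈ Set.Icc (0 : ℝ) 1, lagrangeBracket n z y x = C := by
  rw [ae_restrict_iff' measurableSet_Ioo] at hyeq hzeq
  have hac : AbsolutelyContinuousOnInterval (lagrangeBracket n z y) 0 1 := by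
    refine AbsolutelyContinuousOnInterval.finset_sum _ fun i hi => ?_
    have hi' := Finset.mem_range.mp hi
    exact ((hz.absolutelyContinuousOnInterval hi').smul
      (hy.absolutelyContinuousOnInterval (k := n - 1 - i) (by omega))).const_smul ((-1 : ℂ) ^ i)
  have hdz : ∀ᵐ x, ∀ i < n, x ∈ Set.Ioo (0 : ℝ) 1 →
      HasDerivAt (z i) (quasiRhs fstar z i x) x :=
    ae_all_iff.2 fun i => ae_all_iff.2 fun hi => hz.ae_hasDerivAt hi
  have hdy : ∀ᵐ x, ∀ i < n, x ∈ Set.Ioo (0 : ℝ) 1 → HasDerivAt (y i) (quasiRhs f y i x) x :=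
    ae_all_iff.2 fun i => ae_all_iff.2 fun hi => hy.ae_hasDerivAt hi
  rw [← Set.uIcc_of_le (zero_le_one (α := ℝ))]
  refine hac.const_of_ae_hasDerivAt_zero ?_
  filter_upwards [hdz, hdy, hyeq, hzeq, Measure.ae_ne volume (0 : ℝ),
    Measure.ae_ne volume (1 : ℝ)] with x hxz hxy hye hze h0 h1 hx
  rw [Set.uIcc_of_le zero_le_one] at hx
  have hx01 : x ∈ Set.Ioo (0 : ℝ) 1 :=
    ⟨lt_of_le_of_ne hx.1 (Ne.symm h0), lt_of_le_of_ne hx.2 h1⟩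
  rw [← sum_quasiRhs_mul_add_mul_quasiRhs_eq_zero hfstar (hye hx01) (hze hx01)]
  refine HasDerivAt.fun_sum fun i hi => ?_
  have hi' := Finset.mem_range.mp hi
  exact ((hxz i hi' hx01).mul (hxy (n - 1 - i) (by omega) hx01)).const_mul _

end QuasiDerivatives

section Antidiagonal

variable {n : ℕ} {R : Type*} [CommRing R] {A M N : Matrix (Fin n) (Fin n) R}

theorem transpose_mul_antidiagonal_mul_apply
    (hA : ∀ k j : Fin n, (k : ℕ) + (j : ℕ) + 1 ≠ n → A k j = 0) (a b : Fin n) :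
    (Mᵀ * A * N) a b = ∑ k, M k a * A k k.rev * N k.rev b := by
  rw [Matrix.mul_assoc, Matrix.mul_apply]
  refine Finset.sum_congr rfl fun k _ => ?_
  rw [Matrix.transpose_apply, Matrix.mul_apply, mul_assoc, Finset.sum_eq_single k.rev]
  · intro j _ hj
    rw [hA k j fun h => hj (Fin.ext (by rw [Fin.val_rev]; omega)), zero_mul]
  · simp

theorem transpose_mul_antidiagonal_mul_apply_of_unitLower
    (hA : ∀ k j : Fin n, (k : ℕ) + (j : ℕ) + 1 ≠ n → A k j = 0)
    (hM : ∀ k s : Fin n, s ≤ k → M s k = if s = k then 1 else 0)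
    (hN : ∀ k s : Fin n, s ≤ k → N s k = if s = k then 1 else 0)
    {a b : Fin n} (hab : n ≤ (a : ℕ) + b + 1) : (Mᵀ * A * N) a b = A a b := by
  rw [transpose_mul_antidiagonal_mul_apply hA, Finset.sum_eq_single a]
  · rw [hM a a le_rfl, hN b a.rev (by rw [Fin.le_def, Fin.val_rev]; omega)]
    by_cases h : a.rev = b
    · simp [h]
    · rw [hA a b fun h' => h (Fin.ext (by rw [Fin.val_rev]; omega))]
      simp [h]
  · intro k _ hk
    rcases lt_or_gt_of_ne hk with h | h
    · simp [hM a k h.le, hk]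
    · have hlt : k.rev < b := by
        rw [Fin.lt_def] at h ⊢
        rw [Fin.val_rev]
        omega
      simp [hN b k.rev hlt.le, hlt.ne]
  · simp

theorem transpose_mul_antidiagonal_mul_apply_of_upper
    (hA : ∀ k j : Fin n, (k : ℕ) + (j : ℕ) + 1 ≠ n → A k j = 0)
    (hM : ∀ k s : Fin n, k < s → M s k = 0) (hN : ∀ k s : Fin n, k < s → N s k = 0)
    {a b : Fin n} (hab : (a : ℕ) + b + 1 < n) : (Mᵀ * A * N) a b = 0 := by
  rw [transpose_mul_antidiagonal_mul_apply hA]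
  refine Finset.sum_eq_zero fun k _ => ?_
  rcases lt_or_ge a k with h | h
  · simp [hM a k h]
  · have hlt : b < k.rev := by
      rw [Fin.le_def] at h
      rw [Fin.lt_def, Fin.val_rev]
      omega
    simp [hN b k.rev hlt]

end Antidiagonal

theorem weyl_solutions_pairing_identity
    (n : ℕ) (hn : 2 ≤ n)
    (f fstar : ℕ → ℕ → ℝ → ℂ)
    (hf : ∀ k j, 1 ≤ k → k ≤ n → 1 ≤ j → j ≤ n → IntegrableOn (f k j) (Set.Ioo 0 1))
    (hfstar : ∀ k j x, fstar k j x = (-1 : ℂ) ^ (k + j + 1) * f (n - j + 1) (n - k + 1) x)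
    (lam : ℂ)
    (J : Matrix (Fin n) (Fin n) ℂ)
    (hJ : ∀ k j : Fin n, J k j =
      if (k : ℕ) + (j : ℕ) + 1 = n then (-1 : ℂ) ^ (k : ℕ) else 0)
    (J₀ J₁ : Matrix (Fin n) (Fin n) ℂ)
    (hJ₀ : ∀ k j : Fin n, (k : ℕ) + (j : ℕ) + 1 ≠ n → J₀ k j = 0)
    (hJ₁ : ∀ k j : Fin n, (k : ℕ) + (j : ℕ) + 1 ≠ n → J₁ k j = 0)
    (U₀ U₁ U₀st U₁st : Matrix (Fin n) (Fin n) ℂ)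
    (hU₀ : U₀stᵀ * J₀ * U₀ = J) (hU₁ : U₁stᵀ * J₁ * U₁ = J)
    (Phi Phist : Fin n → ℕ → ℝ → ℂ)
    (hPhi : ∀ k, QuasiChainInt n f (Phi k))
    (hPhieq : ∀ k, ∀ᵐ x ∂(volume.restrict (Set.Ioo (0 : ℝ) 1)), Phi k n x = lam * Phi k 0 x)
    (hPhist : ∀ k, QuasiChainInt n fstar (Phist k))
    (hPhisteq : ∀ k, ∀ᵐ x ∂(volume.restrict (Set.Ioo (0 : ℝ) 1)),
      (-1 : ℂ) ^ n * Phist k n x = lam * Phist k 0 x)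
    (Φ Φst : ℝ → Matrix (Fin n) (Fin n) ℂ)
    (hΦ : ∀ x, ∀ s k : Fin n, Φ x s k = Phi k (s : ℕ) x)
    (hΦst : ∀ x, ∀ s k : Fin n, Φst x s k = Phist k (s : ℕ) x)
    (hbc₀ : ∀ k s : Fin n, s ≤ k → (U₀ * Φ 0) s k = if s = k then 1 else 0)
    (hbc₁ : ∀ k s : Fin n, k < s → (U₁ * Φ 1) s k = 0)
    (hbc₀st : ∀ k s : Fin n, s ≤ k → (U₀st * Φst 0) s k = if s = k then 1 else 0)
    (hbc₁st : ∀ k s : Fin n, k < s → (U₁st * Φst 1) s k = 0) :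
    (∀ x ∈ Set.Icc (0 : ℝ) 1, (Φst x)ᵀ * J * Φ x = J₀) ∧
      (U₀st * Φst 0)ᵀ * J₀ * (U₀ * Φ 0) = J₀ := by
  have hJ' : ∀ k j : Fin n, (k : ℕ) + (j : ℕ) + 1 ≠ n → J k j = 0 := fun k j h => by
    rw [hJ, if_neg h]
  have hpair : ∀ x a b, ((Φst x)ᵀ * J * Φ x) a b = lagrangeBracket n (Phist a) (Phi b) x := by
    intro x a b
    rw [transpose_mul_antidiagonal_mul_apply hJ', lagrangeBracket, Finset.sum_range]
    refine Finset.sum_congr rfl fun k _ => ?_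
    rw [hJ, if_pos (by rw [Fin.val_rev]; omega), hΦ, hΦst, Fin.val_rev,
      show n - ((k : ℕ) + 1) = n - 1 - k by omega]
    ring
  have hconst : ∀ x ∈ Set.Icc (0 : ℝ) 1, ∀ x' ∈ Set.Icc (0 : ℝ) 1,
      (Φst x)ᵀ * J * Φ x = (Φst x')ᵀ * J * Φ x' := by
    intro x hx x' hx'
    ext a b
    obtain ⟨C, hC⟩ := lagrangeBracket_eq_const hfstar (hPhi b) (hPhist a) (hPhieq b) (hPhisteq a)
    rw [hpair, hpair, hC x hx, hC x' hx']
  have h0 : (Φst 0)ᵀ * J * Φ 0 = (U₀st * Φst 0)ᵀ * J₀ * (U₀ * Φ 0) := by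
    simp only [← hU₀, Matrix.transpose_mul, Matrix.mul_assoc]
  have h1 : (Φst 1)ᵀ * J * Φ 1 = (U₁st * Φst 1)ᵀ * J₁ * (U₁ * Φ 1) := by
    simp only [← hU₁, Matrix.transpose_mul, Matrix.mul_assoc]
  have hmem0 : (0 : ℝ) ∈ Set.Icc (0 : ℝ) 1 := by simp
  have hM : (U₀st * Φst 0)ᵀ * J₀ * (U₀ * Φ 0) = J₀ := by
    ext a b
    rcases lt_or_ge ((a : ℕ) + b + 1) n with hab | hab
    · rw [hJ₀ a b hab.ne, ← h0, hconst 0 hmem0 1 (by simp), h1]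
      exact transpose_mul_antidiagonal_mul_apply_of_upper hJ₁ hbc₁st hbc₁ hab
    · exact transpose_mul_antidiagonal_mul_apply_of_unitLower hJ₀ hbc₀st hbc₀ hab
  exact ⟨fun x hx => by rw [hconst x hx 0 hmem0, h0, hM], hM⟩
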